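/- Let β∈[1,2), s=0, s₁=1, and let u be three times continuously differentiable on [a,b]. Then there exist constants C₁,C₂>0, possibly depending on a, b, β, λ, g and the values of u, u′, u″, u‴ on [a,b], but independent of M and h, such that for every integer M≥3 the linear system H U_h = F has a unique solution U_h and ‖U−U_h‖ ≤ C₁ h^{2−β} and ‖U−U_h‖_∞ ≤ C₂ h^{2−β}. -/

import Mathlib

open MeasureTheory Set

noncomputable section

/-- Grid spacing `h = (b−a)/(M+1)`. -/
def gH (a b : ℝ) (M : ℕ) : ℝ := (b - a) / (M + 1)

/-- Grid points `x_i = a + i h`, `i = 0,…,M+1`. -/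
def gX (a b : ℝ) (M i : ℕ) : ℝ := a + i * gH a b M

/-- `A₁(i,s,k) = h^{−s−1} ∫_{x_{k−1}}^{x_k} (x_k−y)(x_i−y)^{s−1−β} dy`. -/
def cA1 (a b β : ℝ) (s M i k : ℕ) : ℝ :=
  gH a b M ^ (-(s : ℝ) - 1) *
    ∫ y in gX a b M (k - 1)..gX a b M k,
      (gX a b M k - y) * (gX a b M i - y) ^ ((s : ℝ) - 1 - β)

/-- `A₂(i,s,k) = h^{−s−1} ∫_{x_{k−1}}^{x_k} (y−x_{k−1})(x_i−y)^{s−1−β} dy`. -/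
def cA2 (a b β : ℝ) (s M i k : ℕ) : ℝ :=
  gH a b M ^ (-(s : ℝ) - 1) *
    ∫ y in gX a b M (k - 1)..gX a b M k,
      (y - gX a b M (k - 1)) * (gX a b M i - y) ^ ((s : ℝ) - 1 - β)

/-- `A₃(i,s,k) = h^{−s−1} ∫_{x_{k−1}}^{x_k} (x_k−y)(y−x_i)^{s−1−β} dy`. -/
def cA3 (a b β : ℝ) (s M i k : ℕ) : ℝ :=
  gH a b M ^ (-(s : ℝ) - 1) *
    ∫ y in gX a b M (k - 1)..gX a b M k,
      (gX a b M k - y) * (y - gX a b M i) ^ ((s : ℝ) - 1 - β)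

/-- `A₄(i,s,k) = h^{−s−1} ∫_{x_{k−1}}^{x_k} (y−x_{k−1})(y−x_i)^{s−1−β} dy`. -/
def cA4 (a b β : ℝ) (s M i k : ℕ) : ℝ :=
  gH a b M ^ (-(s : ℝ) - 1) *
    ∫ y in gX a b M (k - 1)..gX a b M k,
      (y - gX a b M (k - 1)) * (y - gX a b M i) ^ ((s : ℝ) - 1 - β)

/-- `B₁(i) = ∫_{−∞}^a e^{λ(y−x_i)} (x_i−y)^{−1−β} dy`. -/
def cB1 (a b β lam : ℝ) (M i : ℕ) : ℝ :=
  ∫ y in Iio a, Real.exp (lam * (y - gX a b M i)) * (gX a b M i - y) ^ (-1 - β)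

/-- `B₂(i) = ∫_b^∞ e^{λ(x_i−y)} (y−x_i)^{−1−β} dy`. -/
def cB2 (a b β lam : ℝ) (M i : ℕ) : ℝ :=
  ∫ y in Ioi b, Real.exp (lam * (gX a b M i - y)) * (y - gX a b M i) ^ (-1 - β)

/-- Off-diagonal entries `h_{i,j}` (in 1-based indexing, `1 ≤ i,j ≤ M`, `i ≠ j`) of the
stiffness matrix. -/
def offD (a b β lam : ℝ) (s s₁ M i j : ℕ) : ℝ :=
  if j + 2 ≤ i then
    -((cA1 a b β s M i (j + 1) + cA2 a b β s M i j) *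
        Real.exp (-lam * ((i : ℝ) - j) * gH a b M) * ((i : ℝ) - j) ^ (-(s : ℝ)))
  else if j + 1 = i then
    -(gH a b M ^ (-β) * Real.exp (-lam * gH a b M) / ((s₁ : ℝ) + 1 - β))
      - cA2 a b β s M i (i - 1) * Real.exp (-lam * gH a b M)
  else if j = i + 1 then
    -(gH a b M ^ (-β) * Real.exp (-lam * gH a b M) / ((s₁ : ℝ) + 1 - β))
      - cA3 a b β s M i (i + 2) * Real.exp (-lam * gH a b M)
  else if i + 2 ≤ j then
    -((cA3 a b β s M i (j + 1) + cA4 a b β s M i j) *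
        Real.exp (-lam * ((j : ℝ) - i) * gH a b M) * ((j : ℝ) - i) ^ (-(s : ℝ)))
  else 0

/-- The prescribed value of `h_{i,i} + Σ_{j≠i} h_{i,j} − B₁(i) − B₂(i)` (1-based index `i`). -/
def diagExtra (a b β lam : ℝ) (s s₁ M i : ℕ) : ℝ :=
  if i = 1 then
    gH a b M ^ (-β) * Real.exp (-lam * gH a b M) / ((s₁ : ℝ) + 1 - β)
      + cA4 a b β s M 1 (M + 1) * Real.exp (-lam * M * gH a b M) * (M : ℝ) ^ (-(s : ℝ))
  else if i = M then
    gH a b M ^ (-β) * Real.exp (-lam * gH a b M) / ((s₁ : ℝ) + 1 - β)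
      + cA1 a b β s M M 1 * Real.exp (-lam * M * gH a b M) * (M : ℝ) ^ (-(s : ℝ))
  else
    cA1 a b β s M i 1 * Real.exp (-lam * i * gH a b M) * (i : ℝ) ^ (-(s : ℝ))
      + cA4 a b β s M i (M + 1) * Real.exp (-lam * ((M : ℝ) + 1 - i) * gH a b M) *
          ((M : ℝ) + 1 - i) ^ (-(s : ℝ))

/-- The `M×M` stiffness matrix `H = (h_{i,j})`: off-diagonal entries given by `offD`, and
diagonal entries defined so that
`h_{i,i} + Σ_{j≠i} h_{i,j} − B₁(i) − B₂(i) = diagExtra i`. -/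
def stiff (a b β lam : ℝ) (s s₁ M : ℕ) : Matrix (Fin M) (Fin M) ℝ :=
  fun i j =>
    if i = j then
      cB1 a b β lam M (i.val + 1) + cB2 a b β lam M (i.val + 1)
        + diagExtra a b β lam s s₁ M (i.val + 1)
        - ∑ k ∈ Finset.univ.erase i, offD a b β lam s s₁ M (i.val + 1) (k.val + 1)
    else offD a b β lam s s₁ M (i.val + 1) (j.val + 1)

/-- `d₁(i) = ∫_{−∞}^a g(y) e^{−λ(x_i−y)} (x_i−y)^{−1−β} dy`. -/
def dd1 (a b β lam : ℝ) (g : ℝ → ℝ) (M i : ℕ) : ℝ :=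
  ∫ y in Iio a, g y * Real.exp (-lam * (gX a b M i - y)) * (gX a b M i - y) ^ (-1 - β)

/-- `d₂(i) = ∫_b^∞ g(y) e^{−λ(y−x_i)} (y−x_i)^{−1−β} dy`. -/
def dd2 (a b β lam : ℝ) (g : ℝ → ℝ) (M i : ℕ) : ℝ :=
  ∫ y in Ioi b, g y * Real.exp (-lam * (y - gX a b M i)) * (y - gX a b M i) ^ (-1 - β)

/-- The load vector `F`. -/
def loadF (a b β lam : ℝ) (s s₁ : ℕ) (f g u : ℝ → ℝ) (M : ℕ) : Fin M → ℝ :=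
  fun i =>
    f (gX a b M (i.val + 1)) + dd1 a b β lam g M (i.val + 1) + dd2 a b β lam g M (i.val + 1)
      + (if i.val + 1 = 1 then
            gH a b M ^ (-β) * Real.exp (-lam * gH a b M) / ((s₁ : ℝ) + 1 - β)
          else
            cA1 a b β s M (i.val + 1) 1 * Real.exp (-lam * ((i.val : ℝ) + 1) * gH a b M) *
              ((i.val : ℝ) + 1) ^ (-(s : ℝ))) * u a
      + (if i.val + 1 = M then
            gH a b M ^ (-β) * Real.exp (-lam * gH a b M) / ((s₁ : ℝ) + 1 - β)
          else
            cA4 a b β s M (i.val + 1) (M + 1) *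
              Real.exp (-lam * ((M : ℝ) - i.val) * gH a b M) *
              ((M : ℝ) - (i.val : ℝ)) ^ (-(s : ℝ))) * u b

/-- The discrete `L²` norm `‖v‖ = (h Σᵢ vᵢ²)^{1/2}`. -/
def dnorm2 (a b : ℝ) (M : ℕ) (v : Fin M → ℝ) : ℝ :=
  Real.sqrt (gH a b M * ∑ i, v i ^ 2)

end

noncomputable section

open MeasureTheory Set Filter

lemma exists_deriv_bounds {a b : ℝ} (hab : a < b) {u : ℝ → ℝ}
    (hu : ContDiffOn ℝ 3 u (Icc a b)) :
    ∃ (u1 u2 : ℝ → ℝ) (K : ℝ), 0 ≤ K ∧ (∀ x ∈ Icc a b, |u x| ≤ K) ∧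
      ∀ x ∈ Ioo a b, HasDerivAt u (u1 x) x ∧ HasDerivAt u1 (u2 x) x ∧ |u1 x| ≤ K ∧ |u2 x| ≤ K := by
  have hU := uniqueDiffOn_Icc hab
  set u1 := derivWithin u (Icc a b) with hu1
  set u2 := derivWithin u1 (Icc a b) with hu2
  have c1 : ContDiffOn ℝ 2 u1 (Icc a b) := hu.derivWithin hU (by norm_num)
  have c2 : ContDiffOn ℝ 1 u2 (Icc a b) := c1.derivWithin hU (by norm_num)
  obtain ⟨K0, h0⟩ := isCompact_Icc.exists_bound_of_continuousOn hu.continuousOn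
  obtain ⟨K1, h1⟩ := isCompact_Icc.exists_bound_of_continuousOn c1.continuousOn
  obtain ⟨K2, h2⟩ := isCompact_Icc.exists_bound_of_continuousOn c2.continuousOn
  simp only [Real.norm_eq_abs] at h0 h1 h2
  have ha : a ∈ Icc a b := ⟨le_rfl, hab.le⟩
  refine ⟨u1, u2, max K0 (max K1 K2), (abs_nonneg _).trans ((h0 a ha).trans (le_max_left _ _)),
    fun x hx => (h0 x hx).trans (le_max_left _ _), fun x hx => ?_⟩
  have hx' := Ioo_subset_Icc_self hx
  have hn : Icc a b ∈ nhds x := Icc_mem_nhds hx.1 hx.2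
  refine ⟨?_, ?_, (h1 x hx').trans ((le_max_left _ _).trans (le_max_right _ _)),
    (h2 x hx').trans ((le_max_right _ _).trans (le_max_right _ _))⟩
  · exact ((hu.differentiableOn (by norm_num) x hx').hasDerivWithinAt).hasDerivAt hn
  · exact ((c1.differentiableOn (by norm_num) x hx').hasDerivWithinAt).hasDerivAt hn

/-- Error of linear interpolation on `[p, q]` for a function with bounded second derivative. -/
lemma abs_sub_linear_interp_le {w w1 w2 : ℝ → ℝ} {p q K y : ℝ} (hpq : p < q)
    (hc : ContinuousOn w (Icc p q)) (h1 : ∀ z ∈ Ioo p q, HasDerivAt w (w1 z) z)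
    (h2 : ∀ z ∈ Ioo p q, HasDerivAt w1 (w2 z) z) (hK : ∀ z ∈ Ioo p q, |w2 z| ≤ K)
    (hy : y ∈ Icc p q) :
    |w y - (q - p)⁻¹ * ((q - y) * w p + (y - p) * w q)| ≤ K * (q - p) ^ 2 := by
  have hqp : 0 < q - p := sub_pos.2 hpq
  have hK0 : 0 ≤ K := (abs_nonneg _).trans (hK ((p + q) / 2) ⟨by linarith, by linarith⟩)
  rcases eq_or_lt_of_le hy.1 with rfl | hpy
  · have : w p - (q - p)⁻¹ * ((q - p) * w p + (p - p) * w q) = 0 := by field_simp; ring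
    rw [this, abs_zero]; positivity
  obtain ⟨ξ, hξ, hξ'⟩ := exists_hasDerivAt_eq_slope w w1 hpy
    (hc.mono (Icc_subset_Icc_right hy.2)) (fun z hz => h1 z ⟨hz.1, hz.2.trans_le hy.2⟩)
  obtain ⟨η, hη, hη'⟩ := exists_hasDerivAt_eq_slope w w1 hpq hc h1
  have hξ2 : ξ ∈ Ioo p q := ⟨hξ.1, hξ.2.trans_le hy.2⟩
  have hL : |w1 ξ - w1 η| ≤ K * |ξ - η| := by
    simpa only [Real.norm_eq_abs] using
      (convex_Ioo p q).norm_image_sub_le_of_norm_hasDerivWithin_le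
        (fun z hz => (h2 z hz).hasDerivWithinAt) (fun z hz => by simpa using hK z hz) hη hξ2
  have hyp : 0 < y - p := sub_pos.2 hpy
  have e : w y - (q - p)⁻¹ * ((q - y) * w p + (y - p) * w q) = (y - p) * (w1 ξ - w1 η) := by
    rw [hξ', hη']; field_simp; ring
  have hd : |ξ - η| ≤ q - p := by
    rw [abs_le]; constructor <;> linarith [hξ2.1, hξ2.2, hη.1, hη.2]
  rw [e, abs_mul, abs_of_pos hyp, sq]
  calc (y - p) * |w1 ξ - w1 η| ≤ (q - p) * (K * (q - p)) := by
        gcongr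
        · exact hy.2
        · exact hL.trans (by gcongr)
    _ = K * ((q - p) * (q - p)) := by ring

lemma abs_sub_linear_interp_exp_le {u u1 u2 : ℝ → ℝ} {a b K c lam μ x p q y : ℝ}
    (hc : ContinuousOn u (Icc a b)) (hlam : 0 ≤ lam)
    (h0 : ∀ x ∈ Icc a b, |u x| ≤ K)
    (h1 : ∀ x ∈ Ioo a b, HasDerivAt u (u1 x) x ∧ HasDerivAt u1 (u2 x) x ∧
      |u1 x| ≤ K ∧ |u2 x| ≤ K)
    (hcK : |c| ≤ K) (hpq : p < q) (hap : a ≤ p) (hqb : q ≤ b) (hμ : |μ| = lam)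
    (hneg : ∀ z ∈ Icc p q, μ * (z - x) ≤ 0) (hy : y ∈ Icc p q) :
    |(c - u y) * Real.exp (μ * (y - x)) - (q - p)⁻¹ *
      ((q - y) * ((c - u p) * Real.exp (μ * (p - x)))
        + (y - p) * ((c - u q) * Real.exp (μ * (q - x))))|
      ≤ K * (1 + 2 * lam + 2 * lam ^ 2) * (q - p) ^ 2 := by
  have hK0 : 0 ≤ K := (abs_nonneg _).trans hcK
  have hsub : Ioo p q ⊆ Ioo a b := Ioo_subset_Ioo hap hqb
  have hE : ∀ z : ℝ, HasDerivAt (fun z => Real.exp (μ * (z - x)))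
      (μ * Real.exp (μ * (z - x))) z := fun z => by
    have := (((hasDerivAt_id z).sub_const x).const_mul μ).exp
    simpa [mul_comm] using this
  refine abs_sub_linear_interp_le
    (w := fun y => (c - u y) * Real.exp (μ * (y - x)))
    (w1 := fun y => -u1 y * Real.exp (μ * (y - x)) + (c - u y) * (μ * Real.exp (μ * (y - x))))
    (w2 := fun y => (-u2 y * Real.exp (μ * (y - x)) + -u1 y * (μ * Real.exp (μ * (y - x))))
      + (-u1 y * (μ * Real.exp (μ * (y - x)))
        + (c - u y) * (μ * (μ * Real.exp (μ * (y - x))))))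
    hpq ?_ ?_ ?_ ?_ hy
  · exact (continuousOn_const.sub (hc.mono (Icc_subset_Icc hap hqb))).mul (by fun_prop)
  · intro z hz
    exact ((h1 z (hsub hz)).1.const_sub c).mul (hE z)
  · intro z hz
    obtain ⟨d1, d2, -, -⟩ := h1 z (hsub hz)
    exact (d2.neg.mul (hE z)).add ((d1.const_sub c).mul ((hE z).const_mul μ))
  · intro z hz
    obtain ⟨-, -, b1, b2⟩ := h1 z (hsub hz)
    have b0 := h0 z (Ioo_subset_Icc_self (hsub hz))
    have hcu : |c - u z| ≤ 2 * K := (abs_sub _ _).trans (by linarith)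
    have e1 : Real.exp (μ * (z - x)) ≤ 1 := Real.exp_le_one_iff.2 (hneg z (Ioo_subset_Icc_self hz))
    have e0 := (Real.exp_pos (μ * (z - x))).le
    have key : (-u2 z * Real.exp (μ * (z - x)) + -u1 z * (μ * Real.exp (μ * (z - x))))
      + (-u1 z * (μ * Real.exp (μ * (z - x)))
        + (c - u z) * (μ * (μ * Real.exp (μ * (z - x)))))
        = (-u2 z - 2 * (u1 z * μ) + (c - u z) * (μ * μ)) * Real.exp (μ * (z - x)) := by ring
    simp only [key]
    rw [abs_mul, abs_of_nonneg e0]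
    have : |-u2 z - 2 * (u1 z * μ) + (c - u z) * (μ * μ)| ≤ K + 2 * (K * lam)
        + 2 * K * (lam * lam) := by
      refine (abs_add_le _ _).trans (add_le_add ((abs_sub _ _).trans (add_le_add ?_ ?_)) ?_)
      · rwa [abs_neg]
      · rw [abs_mul, abs_mul, hμ, abs_two]; gcongr
      · rw [abs_mul, abs_mul, hμ]; gcongr
    calc _ ≤ (K + 2 * (K * lam) + 2 * K * (lam * lam)) * 1 :=
          mul_le_mul this e1 e0 (by positivity)
      _ = _ := by ring

/-- The product quadrature rule obtained by interpolating `w` linearly on one cell. -/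
lemma abs_integral_sub_cell_le {w κ : ℝ → ℝ} {p q E : ℝ} (hpq : p < q)
    (hw : ContinuousOn w (Icc p q)) (hκ : ContinuousOn κ (Icc p q))
    (hκ0 : ∀ y ∈ Icc p q, 0 ≤ κ y)
    (hE : ∀ y ∈ Icc p q, |w y - (q - p)⁻¹ * ((q - y) * w p + (y - p) * w q)| ≤ E) :
    |(∫ y in p..q, w y * κ y) - ((q - p)⁻¹ * (∫ y in p..q, (q - y) * κ y) * w p
      + (q - p)⁻¹ * (∫ y in p..q, (y - p) * κ y) * w q)| ≤ E * ∫ y in p..q, κ y := by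
  have hI : ∀ {v : ℝ → ℝ}, ContinuousOn v (Icc p q) → IntervalIntegrable v volume p q :=
    fun hv => (by rwa [uIcc_of_le hpq.le] : ContinuousOn _ (uIcc p q)).intervalIntegrable
  have i1 : IntervalIntegrable (fun y => w y * κ y) volume p q := hI (hw.mul hκ)
  have i2 : IntervalIntegrable (fun y => (q - y) * κ y) volume p q :=
    hI (ContinuousOn.mul (by fun_prop) hκ)
  have i3 : IntervalIntegrable (fun y => (y - p) * κ y) volume p q :=
    hI (ContinuousOn.mul (by fun_prop) hκ)
  have e : (∫ y in p..q, w y * κ y) - ((q - p)⁻¹ * (∫ y in p..q, (q - y) * κ y) * w p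
      + (q - p)⁻¹ * (∫ y in p..q, (y - p) * κ y) * w q)
      = ∫ y in p..q, (w y - (q - p)⁻¹ * ((q - y) * w p + (y - p) * w q)) * κ y := by
    have i4 := (i2.const_mul ((q - p)⁻¹ * w p)).add (i3.const_mul ((q - p)⁻¹ * w q))
    have : ∀ y, (w y - (q - p)⁻¹ * ((q - y) * w p + (y - p) * w q)) * κ y
      = w y * κ y - ((q - p)⁻¹ * w p * ((q - y) * κ y) + (q - p)⁻¹ * w q * ((y - p) * κ y)) :=
      fun y => by ring
    simp only [this]
    rw [intervalIntegral.integral_sub i1 i4, intervalIntegral.integral_add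
      (i2.const_mul _) (i3.const_mul _), intervalIntegral.integral_const_mul,
      intervalIntegral.integral_const_mul]
    ring
  rw [e, ← intervalIntegral.integral_const_mul, ← Real.norm_eq_abs]
  refine intervalIntegral.norm_integral_le_of_norm_le hpq.le
    (Filter.Eventually.of_forall fun y hy => ?_) ((hI hκ).const_mul E)
  have hy' := Ioc_subset_Icc_self hy
  rw [Real.norm_eq_abs, abs_mul, abs_of_nonneg (hκ0 y hy')]
  exact mul_le_mul_of_nonneg_right (hE y hy') (hκ0 y hy')

/-- Summing the cell errors over adjacent cells. -/
lemma abs_integral_sub_sum_cells_le {w κ : ℝ → ℝ} {X : ℕ → ℝ} {E : ℝ} {n : ℕ}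
    (hX : StrictMono X) (hw : ContinuousOn w (Icc (X 0) (X n)))
    (hκ : ContinuousOn κ (Icc (X 0) (X n))) (hκ0 : ∀ y, 0 ≤ κ y)
    (hE : ∀ l < n, ∀ y ∈ Icc (X l) (X (l + 1)), |w y - (X (l + 1) - X l)⁻¹ *
      ((X (l + 1) - y) * w (X l) + (y - X l) * w (X (l + 1)))| ≤ E) :
    |(∫ y in X 0..X n, w y * κ y) - ∑ l ∈ Finset.range n,
      ((X (l + 1) - X l)⁻¹ * (∫ y in X l..X (l + 1), (X (l + 1) - y) * κ y) * w (X l)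
      + (X (l + 1) - X l)⁻¹ * (∫ y in X l..X (l + 1), (y - X l) * κ y) * w (X (l + 1)))|
      ≤ E * ∫ y in X 0..X n, κ y := by
  have hsub : ∀ l < n, Icc (X l) (X (l + 1)) ⊆ Icc (X 0) (X n) := fun l hl =>
    Icc_subset_Icc (hX.monotone (Nat.zero_le _)) (hX.monotone hl)
  have hI : ∀ {v : ℝ → ℝ}, ContinuousOn v (Icc (X 0) (X n)) → ∀ l < n,
      IntervalIntegrable v volume (X l) (X (l + 1)) := fun hv l hl =>
    ContinuousOn.intervalIntegrable
      (by rw [uIcc_of_le (hX.monotone l.le_succ)]; exact hv.mono (hsub l hl))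
  rw [← intervalIntegral.sum_integral_adjacent_intervals (hI hκ),
    ← intervalIntegral.sum_integral_adjacent_intervals (f := fun y => w y * κ y)
      (hI (hw.mul hκ)),
    ← Finset.sum_sub_distrib, Finset.mul_sum]
  refine (Finset.abs_sum_le_sum_abs _ _).trans (Finset.sum_le_sum fun l hl => ?_)
  have hl' := Finset.mem_range.1 hl
  exact abs_integral_sub_cell_le (hX l.lt_succ_self) (hw.mono (hsub l hl'))
    (hκ.mono (hsub l hl')) (fun y _ => hκ0 y) (hE l hl')

/-- The singular kernel is continuous away from its centre. -/
lemma continuousOn_abs_sub_rpow {x r : ℝ} {s : Set ℝ} (hs : x ∉ s) :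
    ContinuousOn (fun y => |x - y| ^ r) s :=
  ContinuousOn.rpow_const (by fun_prop) fun y hy =>
    Or.inl (abs_ne_zero.2 (sub_ne_zero.2 fun h => hs (h ▸ hy)))

lemma integral_Icc_rpow_le {β δ t : ℝ} (hβ : 1 ≤ β) (hδ : 0 < δ) (ht : δ ≤ t) :
    ∫ y in δ..t, y ^ (-1 - β) ≤ δ ^ (-β) := by
  have ht0 := hδ.trans_le ht
  have hn : (0 : ℝ) ∉ uIcc δ t := by
    rw [uIcc_of_le ht]
    exact fun h => absurd h.1 hδ.not_ge
  rw [integral_rpow (Or.inr ⟨by linarith, hn⟩)]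
  have e : -1 - β + 1 = -β := by ring
  rw [e, div_neg, ← neg_div, neg_sub]
  have h1 := (Real.rpow_pos_of_pos ht0 (-β)).le
  have h2 := (Real.rpow_pos_of_pos hδ (-β)).le
  rw [div_le_iff₀ (by linarith)]
  nlinarith

lemma integral_kernel_left_le {β δ x a : ℝ} (hβ : 1 ≤ β) (hδ : 0 < δ) (ha : a ≤ x - δ) :
    ∫ y in a..(x - δ), |x - y| ^ (-1 - β) ≤ δ ^ (-β) := by
  rw [intervalIntegral.integral_comp_sub_left (fun t => |t| ^ (-1 - β)) x]
  rw [sub_sub_cancel]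
  refine le_of_eq_of_le (intervalIntegral.integral_congr fun t ht => ?_)
    (integral_Icc_rpow_le hβ hδ (t := x - a) (by linarith))
  rw [uIcc_of_le (by linarith)] at ht
  simp only [abs_of_pos (hδ.trans_le ht.1)]

lemma integral_kernel_right_le {β δ x b : ℝ} (hβ : 1 ≤ β) (hδ : 0 < δ) (hb : x + δ ≤ b) :
    ∫ y in (x + δ)..b, |x - y| ^ (-1 - β) ≤ δ ^ (-β) := by
  simp only [abs_sub_comm x]
  rw [intervalIntegral.integral_comp_sub_right (fun t => |t| ^ (-1 - β)) x]
  rw [add_sub_cancel_left]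
  refine le_of_eq_of_le (intervalIntegral.integral_congr fun t ht => ?_)
    (integral_Icc_rpow_le hβ hδ (t := b - x) (by linarith))
  rw [uIcc_of_le (by linarith)] at ht
  simp only [abs_of_pos (hδ.trans_le ht.1)]

lemma abs_sub_linear_interp_tempered_le {u u1 u2 : ℝ → ℝ} {a b K lam x p q : ℝ}
    (hc : ContinuousOn u (Icc a b)) (hlam : 0 ≤ lam)
    (h0 : ∀ x ∈ Icc a b, |u x| ≤ K)
    (h1 : ∀ x ∈ Ioo a b, HasDerivAt u (u1 x) x ∧ HasDerivAt u1 (u2 x) x ∧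
      |u1 x| ≤ K ∧ |u2 x| ≤ K)
    (hx : x ∈ Icc a b) (hpq : p < q) (hap : a ≤ p) (hqb : q ≤ b) (hxpq : q ≤ x ∨ x ≤ p) :
    ∀ y ∈ Icc p q, |(u x - u y) * Real.exp (-lam * |x - y|) - (q - p)⁻¹ *
      ((q - y) * ((u x - u p) * Real.exp (-lam * |x - p|))
        + (y - p) * ((u x - u q) * Real.exp (-lam * |x - q|)))|
      ≤ K * (1 + 2 * lam + 2 * lam ^ 2) * (q - p) ^ 2 := by
  intro y hy
  have hp : p ∈ Icc p q := ⟨le_rfl, hpq.le⟩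
  have hq : q ∈ Icc p q := ⟨hpq.le, le_rfl⟩
  rcases hxpq with h | h
  · have e : ∀ z ∈ Icc p q, -lam * |x - z| = lam * (z - x) := fun z hz => by
      rw [abs_of_nonneg (by linarith [hz.2])]; ring
    rw [e y hy, e p hp, e q hq]
    exact abs_sub_linear_interp_exp_le hc hlam h0 h1 (h0 x hx) hpq hap hqb (abs_of_nonneg hlam)
      (fun z hz => mul_nonpos_of_nonneg_of_nonpos hlam (by linarith [hz.2])) hy
  · have e : ∀ z ∈ Icc p q, -lam * |x - z| = -lam * (z - x) := fun z hz => by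
      rw [abs_of_nonpos (by linarith [hz.1])]; ring
    rw [e y hy, e p hp, e q hq]
    exact abs_sub_linear_interp_exp_le hc hlam h0 h1 (h0 x hx) hpq hap hqb
      (by rw [abs_neg, abs_of_nonneg hlam])
      (fun z hz => mul_nonpos_of_nonpos_of_nonneg (by linarith) (by linarith [hz.1])) hy

lemma sq_mul_rpow_neg {h β : ℝ} (hh : 0 < h) : h ^ 2 * h ^ (-β) = h ^ (2 - β) := by
  rw [← Real.rpow_two, ← Real.rpow_add hh, sub_eq_add_neg]

lemma gH_pos {a b : ℝ} (hab : a < b) (M : ℕ) : 0 < gH a b M :=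
  div_pos (sub_pos.2 hab) (by positivity)

lemma gX_succ (a b : ℝ) (M i : ℕ) : gX a b M (i + 1) = gX a b M i + gH a b M := by
  simp only [gX]; push_cast; ring

lemma gX_zero (a b : ℝ) (M : ℕ) : gX a b M 0 = a := by simp [gX]

lemma gX_last (a b : ℝ) (M : ℕ) : gX a b M (M + 1) = b := by
  have : (M : ℝ) + 1 ≠ 0 := by positivity
  simp only [gX, gH]; push_cast; field_simp; ring

lemma gX_strictMono {a b : ℝ} (hab : a < b) (M : ℕ) : StrictMono (gX a b M) :=
  strictMono_nat_of_lt_succ fun n => by rw [gX_succ]; linarith [gH_pos hab M]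

lemma gX_mem_Icc {a b : ℝ} (hab : a < b) {M i : ℕ} (hi : i ≤ M + 1) :
    gX a b M i ∈ Icc a b := by
  have h1 := (gX_strictMono hab M).monotone (Nat.zero_le i)
  have h2 := (gX_strictMono hab M).monotone hi
  rw [gX_zero] at h1; rw [gX_last] at h2
  exact ⟨h1, h2⟩

lemma gX_sub (a b : ℝ) (M i j : ℕ) : gX a b M i - gX a b M j = ((i : ℝ) - j) * gH a b M := by
  simp only [gX]; ring

section Coefficients

variable {a b β : ℝ} (hab : a < b) {M i k : ℕ}

include hab

lemma cA1_zero (hk : k + 1 ≤ i) : cA1 a b β 0 M i (k + 1)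
    = (gX a b M (k + 1) - gX a b M k)⁻¹ * ∫ y in gX a b M k..gX a b M (k + 1),
      (gX a b M (k + 1) - y) * |gX a b M i - y| ^ (-1 - β) := by
  have hm := (gX_strictMono hab M).monotone
  simp only [cA1, Nat.cast_zero, neg_zero, zero_sub, Real.rpow_neg_one, Nat.add_sub_cancel]
  rw [gX_succ a b M k, add_sub_cancel_left, ← gX_succ]
  congr 1
  refine intervalIntegral.integral_congr fun y hy => ?_
  rw [uIcc_of_le (hm k.le_succ)] at hy
  simp only [abs_of_nonneg (sub_nonneg.2 (hy.2.trans (hm hk)))]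

lemma cA2_zero (hk : k + 1 ≤ i) : cA2 a b β 0 M i (k + 1)
    = (gX a b M (k + 1) - gX a b M k)⁻¹ * ∫ y in gX a b M k..gX a b M (k + 1),
      (y - gX a b M k) * |gX a b M i - y| ^ (-1 - β) := by
  have hm := (gX_strictMono hab M).monotone
  simp only [cA2, Nat.cast_zero, neg_zero, zero_sub, Real.rpow_neg_one, Nat.add_sub_cancel]
  rw [gX_succ a b M k, add_sub_cancel_left, ← gX_succ]
  congr 1
  refine intervalIntegral.integral_congr fun y hy => ?_
  rw [uIcc_of_le (hm k.le_succ)] at hy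
  simp only [abs_of_nonneg (sub_nonneg.2 (hy.2.trans (hm hk)))]

lemma cA3_zero (hk : i ≤ k) : cA3 a b β 0 M i (k + 1)
    = (gX a b M (k + 1) - gX a b M k)⁻¹ * ∫ y in gX a b M k..gX a b M (k + 1),
      (gX a b M (k + 1) - y) * |gX a b M i - y| ^ (-1 - β) := by
  have hm := (gX_strictMono hab M).monotone
  simp only [cA3, Nat.cast_zero, neg_zero, zero_sub, Real.rpow_neg_one, Nat.add_sub_cancel]
  rw [gX_succ a b M k, add_sub_cancel_left, ← gX_succ]
  congr 1
  refine intervalIntegral.integral_congr fun y hy => ?_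
  rw [uIcc_of_le (hm k.le_succ)] at hy
  simp only [abs_of_nonpos (sub_nonpos.2 ((hm hk).trans hy.1)), neg_sub]

lemma cA4_zero (hk : i ≤ k) : cA4 a b β 0 M i (k + 1)
    = (gX a b M (k + 1) - gX a b M k)⁻¹ * ∫ y in gX a b M k..gX a b M (k + 1),
      (y - gX a b M k) * |gX a b M i - y| ^ (-1 - β) := by
  have hm := (gX_strictMono hab M).monotone
  simp only [cA4, Nat.cast_zero, neg_zero, zero_sub, Real.rpow_neg_one, Nat.add_sub_cancel]
  rw [gX_succ a b M k, add_sub_cancel_left, ← gX_succ]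
  congr 1
  refine intervalIntegral.integral_congr fun y hy => ?_
  rw [uIcc_of_le (hm k.le_succ)] at hy
  simp only [abs_of_nonpos (sub_nonpos.2 ((hm hk).trans hy.1)), neg_sub]

lemma cell_left_nonneg (x : ℝ) : 0 ≤ (gX a b M (k + 1) - gX a b M k)⁻¹ *
    ∫ y in gX a b M k..gX a b M (k + 1), (gX a b M (k + 1) - y) * |x - y| ^ (-1 - β) := by
  have hm := gX_strictMono hab M k.lt_succ_self
  refine mul_nonneg (inv_nonneg.2 (sub_nonneg.2 hm.le))
    (intervalIntegral.integral_nonneg hm.le fun y hy => ?_)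
  exact mul_nonneg (sub_nonneg.2 hy.2) (Real.rpow_nonneg (abs_nonneg _) _)

lemma cell_right_nonneg (x : ℝ) : 0 ≤ (gX a b M (k + 1) - gX a b M k)⁻¹ *
    ∫ y in gX a b M k..gX a b M (k + 1), (y - gX a b M k) * |x - y| ^ (-1 - β) := by
  have hm := gX_strictMono hab M k.lt_succ_self
  refine mul_nonneg (inv_nonneg.2 (sub_nonneg.2 hm.le))
    (intervalIntegral.integral_nonneg hm.le fun y hy => ?_)
  exact mul_nonneg (sub_nonneg.2 hy.1) (Real.rpow_nonneg (abs_nonneg _) _)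

end Coefficients

/-- The tempered difference `(u(x) − u(y)) e^{−λ|x−y|}`. -/
def temperedDiff (lam : ℝ) (u : ℝ → ℝ) (x y : ℝ) : ℝ := (u x - u y) * Real.exp (-lam * |x - y|)

section Quadrature

variable {u u1 u2 : ℝ → ℝ} {a b K lam β : ℝ} (hab : a < b) (hβ : 1 ≤ β) (hlam : 0 ≤ lam)
  (hc : ContinuousOn u (Icc a b)) (h0 : ∀ x ∈ Icc a b, |u x| ≤ K)
  (h1 : ∀ x ∈ Ioo a b, HasDerivAt u (u1 x) x ∧ HasDerivAt u1 (u2 x) x ∧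
    |u1 x| ≤ K ∧ |u2 x| ≤ K)

include hc in
lemma continuousOn_temperedDiff (x : ℝ) : ContinuousOn (temperedDiff lam u x) (Icc a b) :=
  (continuousOn_const.sub hc).mul (by fun_prop)

include hab hβ hlam hc h0 h1

lemma abs_integral_left_sub_sum_le {M p : ℕ} (hp : p ≤ M) :
    |(∫ y in a..gX a b M p, temperedDiff lam u (gX a b M (p + 1)) y *
        |gX a b M (p + 1) - y| ^ (-1 - β)) - ∑ l ∈ Finset.range p,
      (cA1 a b β 0 M (p + 1) (l + 1) * temperedDiff lam u (gX a b M (p + 1)) (gX a b M l)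
      + cA2 a b β 0 M (p + 1) (l + 1) *
        temperedDiff lam u (gX a b M (p + 1)) (gX a b M (l + 1)))|
      ≤ K * (1 + 2 * lam + 2 * lam ^ 2) * gH a b M ^ (2 - β) := by
  have hh := gH_pos hab M
  have hX := gX_strictMono hab M
  have hK0 : 0 ≤ K := (abs_nonneg _).trans (h0 a ⟨le_rfl, hab.le⟩)
  have hsub : Icc (gX a b M 0) (gX a b M p) ⊆ Icc a b := by
    rw [gX_zero]; exact Icc_subset_Icc_right (gX_mem_Icc hab (by omega)).2
  have key := abs_integral_sub_sum_cells_le (w := temperedDiff lam u (gX a b M (p + 1)))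
    (κ := fun y => |gX a b M (p + 1) - y| ^ (-1 - β)) (X := gX a b M) (n := p)
    (E := K * (1 + 2 * lam + 2 * lam ^ 2) * gH a b M ^ 2) hX
    ((continuousOn_temperedDiff hc _).mono hsub)
    (continuousOn_abs_sub_rpow fun h => absurd h.2 (not_le.2 (hX p.lt_succ_self)))
    (fun y => Real.rpow_nonneg (abs_nonneg _) _) fun l hl y hy => by
      have := abs_sub_linear_interp_tempered_le hc hlam h0 h1
        (gX_mem_Icc hab (M := M) (i := p + 1) (by omega)) (hX l.lt_succ_self)
        (gX_mem_Icc hab (M := M) (i := l) (by omega)).1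
        (gX_mem_Icc hab (M := M) (i := l + 1) (by omega)).2
        (Or.inl (hX.monotone (by omega))) y hy
      have e : gH a b M = gX a b M (l + 1) - gX a b M l := by rw [gX_succ]; ring
      rw [e]; exact this
  rw [gX_zero] at key
  have hs : ∀ l ∈ Finset.range p, l + 1 ≤ p + 1 := fun l hl => by
    have := Finset.mem_range.1 hl; omega
  rw [Finset.sum_congr rfl fun l hl => by rw [cA1_zero hab (hs l hl), cA2_zero hab (hs l hl)]]
  refine key.trans ?_
  have hk : ∫ y in a..gX a b M p, |gX a b M (p + 1) - y| ^ (-1 - β) ≤ gH a b M ^ (-β) := by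
    have e : gX a b M p = gX a b M (p + 1) - gH a b M := by rw [gX_succ]; ring
    nth_rewrite 1 [e]
    refine integral_kernel_left_le hβ hh ?_
    rw [← e]; exact (gX_mem_Icc hab (by omega)).1
  calc _ ≤ K * (1 + 2 * lam + 2 * lam ^ 2) * gH a b M ^ 2 * gH a b M ^ (-β) := by gcongr
    _ = _ := by rw [mul_assoc, sq_mul_rpow_neg hh]

lemma abs_integral_right_sub_sum_le {M p q : ℕ} (hM : M = p + 1 + q) :
    |(∫ y in gX a b M (p + 2)..b, temperedDiff lam u (gX a b M (p + 1)) y *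
        |gX a b M (p + 1) - y| ^ (-1 - β)) - ∑ l ∈ Finset.range q,
      (cA3 a b β 0 M (p + 1) (p + 2 + l + 1) *
        temperedDiff lam u (gX a b M (p + 1)) (gX a b M (p + 2 + l))
      + cA4 a b β 0 M (p + 1) (p + 2 + l + 1) *
        temperedDiff lam u (gX a b M (p + 1)) (gX a b M (p + 2 + l + 1)))|
      ≤ K * (1 + 2 * lam + 2 * lam ^ 2) * gH a b M ^ (2 - β) := by
  have hh := gH_pos hab M
  have hX := gX_strictMono hab M
  have hK0 : 0 ≤ K := (abs_nonneg _).trans (h0 a ⟨le_rfl, hab.le⟩)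
  have hb : gX a b M (p + 2 + q) = b := by
    rw [show p + 2 + q = M + 1 by omega, gX_last]
  have hsub : Icc (gX a b M (p + 2)) (gX a b M (p + 2 + q)) ⊆ Icc a b := by
    rw [hb]; exact Icc_subset_Icc_left (gX_mem_Icc hab (by omega)).1
  have key := abs_integral_sub_sum_cells_le (w := temperedDiff lam u (gX a b M (p + 1)))
    (κ := fun y => |gX a b M (p + 1) - y| ^ (-1 - β)) (X := fun l => gX a b M (p + 2 + l)) (n := q)
    (E := K * (1 + 2 * lam + 2 * lam ^ 2) * gH a b M ^ 2) (fun l m h => hX (by omega))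
    ((continuousOn_temperedDiff hc _).mono hsub)
    (continuousOn_abs_sub_rpow fun h => absurd h.1 (not_le.2 (hX (p + 1).lt_succ_self)))
    (fun y => Real.rpow_nonneg (abs_nonneg _) _) fun l hl y hy => by
      have := abs_sub_linear_interp_tempered_le hc hlam h0 h1
        (gX_mem_Icc hab (M := M) (i := p + 1) (by omega)) (hX (p + 2 + l).lt_succ_self)
        (gX_mem_Icc hab (M := M) (i := p + 2 + l) (by omega)).1
        (gX_mem_Icc hab (M := M) (i := p + 2 + l + 1) (by omega)).2
        (Or.inr (hX.monotone (by omega))) y hy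
      have e : gH a b M = gX a b M (p + 2 + l + 1) - gX a b M (p + 2 + l) := by
        rw [gX_succ]; ring
      rw [e]; exact this
  simp only [hb, ← add_assoc, add_zero] at key
  have hs : ∀ l, p + 1 ≤ p + 2 + l := fun l => by omega
  simp only [cA3_zero hab (hs _), cA4_zero hab (hs _)]
  refine key.trans ?_
  have hk : ∫ y in gX a b M (p + 2)..b, |gX a b M (p + 1) - y| ^ (-1 - β) ≤ gH a b M ^ (-β) := by
    have e : gX a b M (p + 2) = gX a b M (p + 1) + gH a b M := gX_succ _ _ _ _
    rw [e]
    refine integral_kernel_right_le hβ hh ?_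
    rw [← e]; exact (gX_mem_Icc hab (by omega)).2
  calc _ ≤ K * (1 + 2 * lam + 2 * lam ^ 2) * gH a b M ^ 2 * gH a b M ^ (-β) := by gcongr
    _ = _ := by rw [mul_assoc, sq_mul_rpow_neg hh]

omit hab hβ hlam h0 in
/-- Second differences are quadratically small. -/
lemma abs_second_difference_le {x t : ℝ} (ht : 0 < t) (hl : a ≤ x - t) (hr : x + t ≤ b) :
    |2 * u x - u (x - t) - u (x + t)| ≤ 8 * K * t ^ 2 := by
  have hsub : Ioo (x - t) (x + t) ⊆ Ioo a b := Ioo_subset_Ioo hl hr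
  have := abs_sub_linear_interp_le (w := u) (y := x) (p := x - t) (q := x + t) (by linarith)
    (hc.mono (Icc_subset_Icc hl hr)) (fun z hz => (h1 z (hsub hz)).1)
    (fun z hz => (h1 z (hsub hz)).2.1) (fun z hz => (h1 z (hsub hz)).2.2.2)
    ⟨by linarith, by linarith⟩
  have e : u x - (x + t - (x - t))⁻¹ * ((x + t - x) * u (x - t) + (x - (x - t)) * u (x + t))
      = (2 * u x - u (x - t) - u (x + t)) / 2 := by
    rw [show x + t - (x - t) = 2 * t by ring, show x + t - x = t by ring,
      show x - (x - t) = t by ring]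
    field_simp
    ring
  rw [e, abs_div, abs_two] at this
  linarith

omit hab hβ h0 in
/-- The integral over the two cells around `x` is `O(h^{2−β})`, uniformly in the cut-off. -/
lemma abs_integral_near_le {x h ε : ℝ} (hK0 : 0 ≤ K) (hβ2 : β < 2) (hε : 0 < ε) (hεh : ε < h)
    (hl : a ≤ x - h) (hr : x + h ≤ b) :
    |(∫ y in (x - h)..(x - ε), temperedDiff lam u x y * |x - y| ^ (-1 - β))
      + ∫ y in (x + ε)..(x + h), temperedDiff lam u x y * |x - y| ^ (-1 - β)|
      ≤ 8 * K / (2 - β) * h ^ (2 - β) := by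
  set F : ℝ → ℝ := fun y => temperedDiff lam u x y * |x - y| ^ (-1 - β) with hF
  have hFc : ∀ s ⊆ Icc a b, x ∉ s → ContinuousOn F s := fun s hs hx =>
    ((continuousOn_temperedDiff hc x).mono hs).mul (continuousOn_abs_sub_rpow hx)
  have cl : ContinuousOn (fun t => F (x - t)) (uIcc ε h) := by
    rw [uIcc_of_le hεh.le]
    exact (hFc (Icc (x - h) (x - ε)) (Icc_subset_Icc hl (by linarith))
      (fun hx => by linarith [hx.2])).comp (by fun_prop)
      fun t ht => ⟨by linarith [ht.2], by linarith [ht.1]⟩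
  have cr : ContinuousOn (fun t => F (x + t)) (uIcc ε h) := by
    rw [uIcc_of_le hεh.le]
    exact (hFc (Icc (x + ε) (x + h)) (Icc_subset_Icc (by linarith) hr)
      (fun hx => by linarith [hx.1])).comp (by fun_prop)
      fun t ht => ⟨by linarith [ht.1], by linarith [ht.2]⟩
  rw [← intervalIntegral.integral_comp_sub_left F x, ← intervalIntegral.integral_comp_add_left F x,
    ← intervalIntegral.integral_add cl.intervalIntegrable cr.intervalIntegrable,
    ← Real.norm_eq_abs]
  have hg : IntervalIntegrable (fun t : ℝ => 8 * K * t ^ (1 - β)) volume ε h :=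
    (intervalIntegral.intervalIntegrable_rpow' (by linarith)).const_mul _
  refine (intervalIntegral.norm_integral_le_of_norm_le hεh.le
    (Filter.Eventually.of_forall fun t ht => ?_) hg).trans ?_
  · have ht0 : 0 < t := hε.trans ht.1
    have e : F (x - t) + F (x + t) = (2 * u x - u (x - t) - u (x + t)) *
        (Real.exp (-lam * t) * t ^ (-1 - β)) := by
      simp only [hF, temperedDiff, sub_sub_cancel, sub_add_cancel_left, abs_neg, abs_of_pos ht0]
      ring
    have h2 := abs_second_difference_le (x := x) hc h1 ht0 (by linarith [ht.2]) (by linarith [ht.2])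
    have he : Real.exp (-lam * t) ≤ 1 := Real.exp_le_one_iff.2 (by nlinarith)
    have hr0 : 0 ≤ t ^ (-1 - β) := Real.rpow_nonneg ht0.le _
    rw [e, Real.norm_eq_abs, abs_mul, abs_of_nonneg (mul_nonneg (Real.exp_pos _).le hr0)]
    calc _ ≤ 8 * K * t ^ 2 * (1 * t ^ (-1 - β)) := by gcongr
      _ = 8 * K * t ^ (1 - β) := by
        rw [one_mul, mul_assoc, ← Real.rpow_natCast, ← Real.rpow_add ht0]
        congr 2; push_cast; ring
  · rw [intervalIntegral.integral_const_mul, integral_rpow (Or.inl (by linarith)),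
      show 1 - β + 1 = 2 - β by ring]
    have := Real.rpow_nonneg hε.le (2 - β)
    have h2 : 0 < 2 - β := by linarith
    rw [div_mul_eq_mul_div, mul_div_assoc]
    gcongr
    linarith

end Quadrature

section PrincipalValue

variable {u g : ℝ → ℝ} {a b lam β x : ℝ}

lemma integrableOn_kernel_left {δ : ℝ} (hβ : 1 ≤ β) (hδ : 0 < δ) :
    IntegrableOn (fun y => |x - y| ^ (-1 - β)) (Iic (x - δ)) := by
  have h : Integrable ((Ici δ).indicator fun t : ℝ => t ^ (-1 - β)) := by
    rw [integrable_indicator_iff measurableSet_Ici, integrableOn_Ici_iff_integrableOn_Ioi]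
    exact integrableOn_Ioi_rpow_of_lt (by linarith) hδ
  refine (h.comp_sub_left x).integrableOn.congr_fun (fun y hy => ?_) measurableSet_Iic
  have hy' : δ ≤ x - y := by linarith [mem_Iic.1 hy]
  simp only [indicator_of_mem (mem_Ici.2 hy'), abs_of_pos (hδ.trans_le hy')]

lemma integrableOn_kernel_right {δ : ℝ} (hβ : 1 ≤ β) (hδ : 0 < δ) :
    IntegrableOn (fun y => |x - y| ^ (-1 - β)) (Ici (x + δ)) := by
  have h : Integrable ((Ici δ).indicator fun t : ℝ => t ^ (-1 - β)) := by
    rw [integrable_indicator_iff measurableSet_Ici, integrableOn_Ici_iff_integrableOn_Ioi]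
    exact integrableOn_Ioi_rpow_of_lt (by linarith) hδ
  refine (h.comp_sub_right x).integrableOn.congr_fun (fun y hy => ?_) measurableSet_Ici
  have hy' : δ ≤ y - x := by linarith [mem_Ici.1 hy]
  simp only [indicator_of_mem (mem_Ici.2 hy'), abs_sub_comm x y, abs_of_pos (hδ.trans_le hy')]

lemma IntegrableOn.tempered {s : Set ℝ} (hlam : 0 ≤ lam)
    (h : IntegrableOn (fun y => |x - y| ^ (-1 - β)) s) :
    IntegrableOn (fun y => Real.exp (-lam * |x - y|) * |x - y| ^ (-1 - β)) s := by
  refine Integrable.mono h (Measurable.aestronglyMeasurable (by fun_prop))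
    (Filter.Eventually.of_forall fun y => ?_)
  have h0 : Real.exp (-lam * |x - y|) ≤ 1 :=
    Real.exp_le_one_iff.2 (by nlinarith [abs_nonneg (x - y)])
  rw [norm_mul, Real.norm_eq_abs, abs_of_pos (Real.exp_pos _)]
  exact mul_le_of_le_one_left (norm_nonneg _) h0

variable (hg : Measurable g)
  (hug : ∀ x, x ∉ Ioo a b → u x = g x)
  (hgint : IntegrableOn (fun y => |g y| * Real.exp (-lam * |x - y|) * |x - y| ^ (-1 - β))
    (Ioo a b)ᶜ volume)

include hg hgint in
lemma integrableOn_exterior_data :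
    IntegrableOn (fun y => g y * (Real.exp (-lam * |x - y|) * |x - y| ^ (-1 - β)))
      (Ioo a b)ᶜ := by
  refine Integrable.mono hgint (Measurable.aestronglyMeasurable (by fun_prop))
    (Filter.Eventually.of_forall fun y => le_of_eq ?_)
  simp only [norm_mul, norm_abs_eq_norm, mul_assoc]

include hg hug hgint

lemma integral_left_tail (hβ : 1 ≤ β) (hlam : 0 ≤ lam) (hc : ContinuousOn u (Icc a b))
    {h ε : ℝ} (hε : 0 < ε) (hεh : ε < h) (hl : a ≤ x - h) (hxb : x ≤ b) :
    IntegrableOn (fun y => temperedDiff lam u x y * |x - y| ^ (-1 - β)) (Iic (x - ε)) ∧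
    ∫ y in Iio (x - ε), temperedDiff lam u x y * |x - y| ^ (-1 - β)
      = u x * (∫ y in Iio a, Real.exp (lam * (y - x)) * (x - y) ^ (-1 - β))
        - (∫ y in Iio a, g y * Real.exp (-lam * (x - y)) * (x - y) ^ (-1 - β))
        + (∫ y in a..(x - h), temperedDiff lam u x y * |x - y| ^ (-1 - β))
        + ∫ y in (x - h)..(x - ε), temperedDiff lam u x y * |x - y| ^ (-1 - β) := by
  set F : ℝ → ℝ := fun y => temperedDiff lam u x y * |x - y| ^ (-1 - β) with hF
  have hsub : Iic a ⊆ (Ioo a b)ᶜ := fun y hy h => absurd h.1 (not_lt.2 hy)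
  have iK : IntegrableOn (fun y => Real.exp (-lam * |x - y|) * |x - y| ^ (-1 - β)) (Iic a) :=
    IntegrableOn.tempered hlam
      ((integrableOn_kernel_left (x := x) hβ (hε.trans hεh)).mono_set (Iic_subset_Iic.2 hl))
  have iG := (integrableOn_exterior_data hg hgint).mono_set hsub
  have eF : ∀ y ∈ Iic a, F y = u x * (Real.exp (-lam * |x - y|) * |x - y| ^ (-1 - β))
      - g y * (Real.exp (-lam * |x - y|) * |x - y| ^ (-1 - β)) := fun y hy => by
    simp only [hF, temperedDiff, hug y (hsub hy)]; ring
  have i1 : IntegrableOn F (Iic a) :=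
    IntegrableOn.congr_fun ((Integrable.const_mul iK (u x)).sub iG)
      (fun y hy => (eF y hy).symm) (measurableSet_Iic (a := a))
  have hFc : ContinuousOn F (Icc a (x - ε)) :=
    ((continuousOn_temperedDiff hc x).mono (Icc_subset_Icc_right (by linarith))).mul
      (continuousOn_abs_sub_rpow fun hx => by linarith [hx.2])
  have i2 : IntegrableOn F (Iic (x - ε)) := by
    rw [← Iic_union_Icc_eq_Iic (show a ≤ x - ε by linarith)]
    exact i1.union hFc.integrableOn_Icc
  refine ⟨i2, ?_⟩
  have e1 : ∫ y in Iic a, F y = u x * (∫ y in Iio a, Real.exp (lam * (y - x)) *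
      (x - y) ^ (-1 - β)) - ∫ y in Iio a, g y * Real.exp (-lam * (x - y)) *
      (x - y) ^ (-1 - β) := by
    rw [setIntegral_congr_fun (measurableSet_Iic (a := a)) eF, integral_sub (Integrable.const_mul iK _) iG,
      integral_const_mul, integral_Iic_eq_integral_Iio, integral_Iic_eq_integral_Iio]
    have ha : ∀ y ∈ Iio a, |x - y| = x - y := fun y hy =>
      abs_of_nonneg (by linarith [mem_Iio.1 hy])
    refine congrArg₂ (· - ·) (congrArg (u x * ·) ?_) ?_
    · refine setIntegral_congr_fun measurableSet_Iio fun y hy => ?_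
      simp only [ha y hy]; congr 2; ring
    · refine setIntegral_congr_fun measurableSet_Iio fun y hy => ?_
      simp only [ha y hy]; ring
  have hI : ∀ p q, a ≤ p → p ≤ q → q ≤ x - ε → IntervalIntegrable F volume p q :=
    fun p q hp hpq hq => ContinuousOn.intervalIntegrable
      (by rw [uIcc_of_le hpq]; exact hFc.mono (Icc_subset_Icc hp hq))
  rw [← integral_Iic_eq_integral_Iio, ← e1, add_assoc,
    intervalIntegral.integral_add_adjacent_intervals (hI _ _ le_rfl hl (by linarith))
      (hI _ _ hl (by linarith) le_rfl),
    ← intervalIntegral.integral_Iic_sub_Iic i1 i2]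
  ring

lemma integral_right_tail (hβ : 1 ≤ β) (hlam : 0 ≤ lam) (hc : ContinuousOn u (Icc a b))
    {h ε : ℝ} (hε : 0 < ε) (hεh : ε < h) (hr : x + h ≤ b) (hax : a ≤ x) :
    IntegrableOn (fun y => temperedDiff lam u x y * |x - y| ^ (-1 - β)) (Ioi (x + ε)) ∧
    ∫ y in Ioi (x + ε), temperedDiff lam u x y * |x - y| ^ (-1 - β)
      = u x * (∫ y in Ioi b, Real.exp (lam * (x - y)) * (y - x) ^ (-1 - β))
        - (∫ y in Ioi b, g y * Real.exp (-lam * (y - x)) * (y - x) ^ (-1 - β))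
        + (∫ y in (x + h)..b, temperedDiff lam u x y * |x - y| ^ (-1 - β))
        + ∫ y in (x + ε)..(x + h), temperedDiff lam u x y * |x - y| ^ (-1 - β) := by
  set F : ℝ → ℝ := fun y => temperedDiff lam u x y * |x - y| ^ (-1 - β) with hF
  have hsub : Ioi b ⊆ (Ioo a b)ᶜ := fun y hy h => absurd h.2 (not_lt.2 (le_of_lt hy))
  have iK : IntegrableOn (fun y => Real.exp (-lam * |x - y|) * |x - y| ^ (-1 - β)) (Ioi b) :=
    IntegrableOn.tempered hlam ((integrableOn_kernel_right (x := x) hβ (hε.trans hεh)).mono_set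
      fun y hy => hr.trans (le_of_lt hy))
  have iG := (integrableOn_exterior_data hg hgint).mono_set hsub
  have eF : ∀ y ∈ Ioi b, F y = u x * (Real.exp (-lam * |x - y|) * |x - y| ^ (-1 - β))
      - g y * (Real.exp (-lam * |x - y|) * |x - y| ^ (-1 - β)) := fun y hy => by
    simp only [hF, temperedDiff, hug y (hsub hy)]; ring
  have i1 : IntegrableOn F (Ioi b) :=
    IntegrableOn.congr_fun ((Integrable.const_mul iK (u x)).sub iG)
      (fun y hy => (eF y hy).symm) (measurableSet_Ioi (a := b))
  have hFc : ContinuousOn F (Icc (x + ε) b) :=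
    ((continuousOn_temperedDiff hc x).mono (Icc_subset_Icc_left (by linarith))).mul
      (continuousOn_abs_sub_rpow fun hx => by linarith [hx.1])
  have i2 : IntegrableOn F (Ioi (x + ε)) := by
    rw [← Ioc_union_Ioi_eq_Ioi (show x + ε ≤ b by linarith)]
    exact (hFc.integrableOn_Icc.mono_set Ioc_subset_Icc_self).union i1
  refine ⟨i2, ?_⟩
  have e1 : ∫ y in Ioi b, F y = u x * (∫ y in Ioi b, Real.exp (lam * (x - y)) *
      (y - x) ^ (-1 - β)) - ∫ y in Ioi b, g y * Real.exp (-lam * (y - x)) *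
      (y - x) ^ (-1 - β) := by
    rw [setIntegral_congr_fun (measurableSet_Ioi (a := b)) eF, integral_sub (Integrable.const_mul iK _) iG,
      integral_const_mul]
    have ha : ∀ y ∈ Ioi b, |x - y| = y - x := fun y hy => by
      rw [abs_of_nonpos (by linarith [mem_Ioi.1 hy]), neg_sub]
    refine congrArg₂ (· - ·) (congrArg (u x * ·) ?_) ?_
    · refine setIntegral_congr_fun measurableSet_Ioi fun y hy => ?_
      simp only [ha y hy]; congr 2; ring
    · refine setIntegral_congr_fun measurableSet_Ioi fun y hy => ?_
      simp only [ha y hy]; ring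
  have hI : ∀ p q, x + ε ≤ p → p ≤ q → q ≤ b → IntervalIntegrable F volume p q :=
    fun p q hp hpq hq => ContinuousOn.intervalIntegrable
      (by rw [uIcc_of_le hpq]; exact hFc.mono (Icc_subset_Icc hp hq))
  rw [← intervalIntegral.integral_interval_add_Ioi i2 i1, ← e1,
    ← intervalIntegral.integral_add_adjacent_intervals (hI (x + ε) (x + h) le_rfl (by linarith) hr)
      (hI _ _ (by linarith) hr le_rfl)]
  ring

lemma integral_truncated (hβ : 1 ≤ β) (hlam : 0 ≤ lam) (hc : ContinuousOn u (Icc a b))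
    {h ε : ℝ} (hε : 0 < ε) (hεh : ε < h) (hl : a ≤ x - h) (hr : x + h ≤ b) :
    ∫ y in {y : ℝ | ε < |x - y|}, (u x - u y) * Real.exp (-lam * |x - y|) * |x - y| ^ (-1 - β)
      = (u x * (∫ y in Iio a, Real.exp (lam * (y - x)) * (x - y) ^ (-1 - β))
        - (∫ y in Iio a, g y * Real.exp (-lam * (x - y)) * (x - y) ^ (-1 - β))
        + (∫ y in a..(x - h), temperedDiff lam u x y * |x - y| ^ (-1 - β))
        + ∫ y in (x - h)..(x - ε), temperedDiff lam u x y * |x - y| ^ (-1 - β))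
      + (u x * (∫ y in Ioi b, Real.exp (lam * (x - y)) * (y - x) ^ (-1 - β))
        - (∫ y in Ioi b, g y * Real.exp (-lam * (y - x)) * (y - x) ^ (-1 - β))
        + (∫ y in (x + h)..b, temperedDiff lam u x y * |x - y| ^ (-1 - β))
        + ∫ y in (x + ε)..(x + h), temperedDiff lam u x y * |x - y| ^ (-1 - β)) := by
  obtain ⟨i1, e1⟩ := integral_left_tail hg hug hgint hβ hlam hc hε hεh hl (by linarith)
  obtain ⟨i2, e2⟩ := integral_right_tail hg hug hgint hβ hlam hc hε hεh hr (by linarith)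
  have hS : {y : ℝ | ε < |x - y|} = Iio (x - ε) ∪ Ioi (x + ε) := by
    ext y
    simp only [mem_ofPred_eq, mem_union, mem_Iio, mem_Ioi, lt_abs]
    constructor <;> rintro (h | h) <;> [left; right; left; right] <;> linarith
  have hd : Disjoint (Iio (x - ε)) (Ioi (x + ε)) :=
    Set.disjoint_left.2 fun y h1 h2 => by linarith [mem_Iio.1 h1, mem_Ioi.1 h2]
  rw [hS, ← e1, ← e2]
  exact setIntegral_union hd measurableSet_Ioi (i1.mono_set Iio_subset_Iic_self) i2

end PrincipalValue

section Stability

/-- Maximum principle for a diagonally dominant matrix with non-positive off-diagonal entries. -/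
lemma abs_le_of_mulVec_le {ι : Type*} [Fintype ι] [DecidableEq ι] {A : Matrix ι ι ℝ} {c T : ℝ}
    (hc : 0 < c) (hoff : ∀ i j, i ≠ j → A i j ≤ 0) (hrow : ∀ i, c ≤ ∑ j, A i j)
    {e : ι → ℝ} (he : ∀ i, |A.mulVec e i| ≤ T) (i : ι) : |e i| ≤ T / c := by
  have : Nonempty ι := ⟨i⟩
  obtain ⟨m, hm⟩ := Finite.exists_max fun i => |e i|
  refine (hm i).trans ?_
  rw [le_div_iff₀ hc]
  refine le_trans ?_ (he m)
  have h1 : A.mulVec e m = (∑ j, A m j) * e m + ∑ j, A m j * (e j - e m) := by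
    rw [Finset.sum_mul, ← Finset.sum_add_distrib]
    exact Finset.sum_congr rfl fun j _ => by ring
  have hsgn : ∀ σ : ℝ, σ * e m = |e m| → |σ| = 1 → |e m| * c ≤ σ * A.mulVec e m := by
    intro σ hσ hσ1
    have h2 : 0 ≤ ∑ j, σ * (A m j * (e j - e m)) := by
      refine Finset.sum_nonneg fun j _ => ?_
      rcases eq_or_ne m j with rfl | hj
      · simp
      · have h3 : σ * e j ≤ |e m| := (le_abs_self _).trans (by
          rw [abs_mul, hσ1, one_mul]; exact hm j)
        have := mul_nonneg_of_nonpos_of_nonpos (hoff m j hj) (by linarith : σ * e j - |e m| ≤ 0)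
        rw [← hσ] at this
        linarith [this]
    rw [h1, mul_add, Finset.mul_sum]
    have h4 : σ * ((∑ j, A m j) * e m) = |e m| * ∑ j, A m j := by rw [← hσ]; ring
    have := mul_le_mul_of_nonneg_left (hrow m) (abs_nonneg (e m))
    linarith
  rcases le_total 0 (e m) with h | h
  · have := hsgn 1 (by rw [one_mul, abs_of_nonneg h]) (by simp)
    rw [one_mul] at this
    exact this.trans (le_abs_self _)
  · have := hsgn (-1) (by rw [neg_one_mul, abs_of_nonpos h]) (by simp)
    rw [neg_one_mul] at this
    exact this.trans (neg_le_abs _)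

lemma existsUnique_mulVec_eq {ι : Type*} [Fintype ι] [DecidableEq ι] {A : Matrix ι ι ℝ} {c : ℝ}
    (hc : 0 < c) (hoff : ∀ i j, i ≠ j → A i j ≤ 0) (hrow : ∀ i, c ≤ ∑ j, A i j) (F : ι → ℝ) :
    ∃! v, A.mulVec v = F := by
  have hinj : Function.Injective A.mulVec := by
    intro v w hvw
    funext i
    have := abs_le_of_mulVec_le hc hoff hrow (e := v - w) (T := 0)
      (fun i => by rw [Matrix.mulVec_sub, hvw]; simp) i
    rw [zero_div] at this
    exact sub_eq_zero.1 (abs_nonpos_iff.1 this)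
  obtain ⟨v, hv⟩ := Matrix.mulVec_surjective_iff_isUnit.2
    (Matrix.mulVec_injective_iff_isUnit.1 hinj) F
  exact ⟨v, hv, fun w hw => hinj (hw.trans hv.symm)⟩

end Stability

section Rows

variable {a b β lam : ℝ}

lemma stiff_mulVec (s s₁ M : ℕ) (v : Fin M → ℝ) (i : Fin M) :
    (stiff a b β lam s s₁ M).mulVec v i
      = (cB1 a b β lam M (i.val + 1) + cB2 a b β lam M (i.val + 1)
          + diagExtra a b β lam s s₁ M (i.val + 1)) * v i
        - ∑ k ∈ Finset.univ.erase i,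
          offD a b β lam s s₁ M (i.val + 1) (k.val + 1) * (v i - v k) := by
  rw [Matrix.mulVec, dotProduct, ← Finset.add_sum_erase Finset.univ _ (Finset.mem_univ i)]
  rw [Finset.sum_congr rfl fun k hk => by
    rw [stiff, if_neg (Finset.ne_of_mem_erase hk).symm]]
  simp only [stiff, if_true, mul_sub, Finset.sum_sub_distrib, ← Finset.sum_mul]
  ring

lemma offD_nonpos (hab : a < b) (hβ2 : β < 2) {M i j : ℕ} (hj : 1 ≤ j) :
    offD a b β lam 0 1 M i j ≤ 0 := by
  obtain ⟨j, rfl⟩ := Nat.exists_eq_add_of_le' hj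
  have hν : 0 ≤ gH a b M ^ (-β) * Real.exp (-lam * gH a b M) / (((1 : ℕ) : ℝ) + 1 - β) :=
    div_nonneg (mul_nonneg (Real.rpow_nonneg (gH_pos hab M).le _) (Real.exp_pos _).le)
      (by push_cast; linarith)
  rw [offD]
  split_ifs with h1 h2 h3 h4
  · rw [cA1_zero hab (by omega), cA2_zero hab (by omega), Nat.cast_zero, neg_zero,
      Real.rpow_zero, mul_one, neg_nonpos]
    exact mul_nonneg (add_nonneg (cell_left_nonneg hab _) (cell_right_nonneg hab _))
      (Real.exp_pos _).le
  · rw [show i - 1 = j + 1 by omega, cA2_zero hab (by omega)]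
    linarith [mul_nonneg (cell_right_nonneg (β := β) (M := M) (k := j) hab (gX a b M i))
      (Real.exp_pos (-lam * gH a b M)).le]
  · rw [cA3_zero hab (by omega)]
    linarith [mul_nonneg (cell_left_nonneg (β := β) (M := M) (k := i + 1) hab (gX a b M i))
      (Real.exp_pos (-lam * gH a b M)).le]
  · rw [cA3_zero hab (by omega), cA4_zero hab (by omega), Nat.cast_zero, neg_zero,
      Real.rpow_zero, mul_one, neg_nonpos]
    exact mul_nonneg (add_nonneg (cell_left_nonneg hab _) (cell_right_nonneg hab _))
      (Real.exp_pos _).le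
  · exact le_rfl

lemma diagExtra_nonneg (hab : a < b) (hβ2 : β < 2) {M i : ℕ} (hi : 1 ≤ i) (hiM : i ≤ M) :
    0 ≤ diagExtra a b β lam 0 1 M i := by
  have hν : 0 ≤ gH a b M ^ (-β) * Real.exp (-lam * gH a b M) / (((1 : ℕ) : ℝ) + 1 - β) :=
    div_nonneg (mul_nonneg (Real.rpow_nonneg (gH_pos hab M).le _) (Real.exp_pos _).le)
      (by push_cast; linarith)
  have h1 : 0 ≤ cA1 a b β 0 M i 1 := by
    rw [show (1 : ℕ) = 0 + 1 from rfl, cA1_zero hab (by omega)]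
    exact cell_left_nonneg hab _
  have h4 : 0 ≤ cA4 a b β 0 M i (M + 1) := by
    rw [cA4_zero hab hiM]
    exact cell_right_nonneg hab _
  rw [diagExtra, Nat.cast_zero, neg_zero]
  simp only [Real.rpow_zero, mul_one]
  split_ifs with h h'
  · subst h
    exact add_nonneg hν (mul_nonneg h4 (Real.exp_pos _).le)
  · subst h'
    exact add_nonneg hν (mul_nonneg h1 (Real.exp_pos _).le)
  · exact add_nonneg (mul_nonneg h1 (Real.exp_pos _).le) (mul_nonneg h4 (Real.exp_pos _).le)

lemma le_cB1 (hβ : 1 ≤ β) (hlam : 0 ≤ lam) {M i : ℕ}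
    (hx : gX a b M i ∈ Ioo a b) :
    Real.exp (-lam * (b - a + 1)) * (b - a + 1) ^ (-1 - β) ≤ cB1 a b β lam M i := by
  set x := gX a b M i with hxd
  have hD : 0 < b - a + 1 := by linarith [hx.1, hx.2]
  have hi : IntegrableOn (fun y => Real.exp (lam * (y - x)) * (x - y) ^ (-1 - β)) (Iio a) := by
    have h := (IntegrableOn.tempered hlam (integrableOn_kernel_left (x := x) hβ
      (sub_pos.2 hx.1))).mono_set (show Iio a ⊆ Iic (x - (x - a)) by
        rw [sub_sub_cancel]; exact Iio_subset_Iic_self)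
    refine h.congr_fun (fun y hy => ?_) measurableSet_Iio
    have : 0 ≤ x - y := by linarith [mem_Iio.1 hy, hx.1]
    simp only [abs_of_nonneg this]
    congr 2; ring
  have hsub : Ioo (a - 1) a ⊆ Iio a := fun y hy => hy.2
  calc Real.exp (-lam * (b - a + 1)) * (b - a + 1) ^ (-1 - β)
      = ∫ _ in Ioo (a - 1) a, Real.exp (-lam * (b - a + 1)) * (b - a + 1) ^ (-1 - β) := by
        rw [setIntegral_const]; simp
    _ ≤ ∫ y in Ioo (a - 1) a, Real.exp (lam * (y - x)) * (x - y) ^ (-1 - β) := by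
        refine setIntegral_mono_on (integrableOn_const (by simp)) (hi.mono_set hsub) measurableSet_Ioo
          fun y hy => ?_
        have h0 : 0 < x - y := by linarith [hy.2, hx.1]
        have h1 : x - y ≤ b - a + 1 := by linarith [hy.1, hx.2]
        refine mul_le_mul (Real.exp_le_exp.2 ?_)
          (Real.rpow_le_rpow_of_nonpos h0 h1 (by linarith)) (by positivity) (Real.exp_pos _).le
        nlinarith
    _ ≤ ∫ y in Iio a, Real.exp (lam * (y - x)) * (x - y) ^ (-1 - β) := by
        refine setIntegral_mono_set hi ?_ hsub.eventuallyLE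
        refine (ae_restrict_mem measurableSet_Iio).mono fun y hy => ?_
        exact mul_nonneg (Real.exp_pos _).le
          (Real.rpow_nonneg (by linarith [mem_Iio.1 hy, hx.1]) _)

lemma cB2_nonneg {M i : ℕ} (hx : gX a b M i ≤ b) : 0 ≤ cB2 a b β lam M i :=
  setIntegral_nonneg measurableSet_Ioi fun y hy => mul_nonneg (Real.exp_pos _).le
    (Real.rpow_nonneg (by linarith [mem_Ioi.1 hy]) _)

/-- Weight with which a row couples to its two neighbouring nodes through the singular cells. -/
def nearWeight (a b β lam : ℝ) (M : ℕ) : ℝ :=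
  gH a b M ^ (-β) * Real.exp (-lam * gH a b M) / (((1 : ℕ) : ℝ) + 1 - β)

/-- Weight with which row `p + 1` couples to the boundary value `u(a)`. -/
def leftWeight (a b β lam : ℝ) (M p : ℕ) : ℝ :=
  if p + 1 = 1 then nearWeight a b β lam M
  else cA1 a b β 0 M (p + 1) 1 * Real.exp (-lam * ((p : ℝ) + 1) * gH a b M) *
    ((p : ℝ) + 1) ^ (-((0 : ℕ) : ℝ))

/-- Weight with which row `p + 1` couples to the boundary value `u(b)`. -/
def rightWeight (a b β lam : ℝ) (M p : ℕ) : ℝ :=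
  if p + 1 = M then nearWeight a b β lam M
  else cA4 a b β 0 M (p + 1) (M + 1) * Real.exp (-lam * ((M : ℝ) - p) * gH a b M) *
    ((M : ℝ) - (p : ℝ)) ^ (-((0 : ℕ) : ℝ))

lemma diagExtra_eq {M p : ℕ} (hM : 2 ≤ M) :
    diagExtra a b β lam 0 1 M (p + 1) = leftWeight a b β lam M p + rightWeight a b β lam M p := by
  simp only [diagExtra, leftWeight, rightWeight, nearWeight, Nat.cast_zero, neg_zero,
    Real.rpow_zero, mul_one]
  split_ifs with h1 h2 h2
  · omega
  · obtain rfl : p = 0 := by omega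
    simp
  · subst h2
    push_cast
    ring
  · push_cast
    congr 4
    ring

lemma leftWeight_mul_sub_sum (M p : ℕ) (d : ℕ → ℝ) :
    leftWeight a b β lam M p * d 0
        - ∑ j ∈ Finset.range p, offD a b β lam 0 1 M (p + 1) (j + 1) * d (j + 1)
      = nearWeight a b β lam M * d p + ∑ l ∈ Finset.range p,
        (cA1 a b β 0 M (p + 1) (l + 1) *
            (d l * Real.exp (-lam * (((p + 1 : ℕ) : ℝ) - l) * gH a b M))
          + cA2 a b β 0 M (p + 1) (l + 1) *
            (d (l + 1) * Real.exp (-lam * (((p + 1 : ℕ) : ℝ) - (l + 1 : ℕ)) * gH a b M))) := by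
  rcases p with _ | p
  · simp [leftWeight]
  · rw [Finset.sum_range_succ, Finset.sum_add_distrib, Finset.sum_range_succ',
      Finset.sum_range_succ (n := p)]
    have h1 : ∀ j ∈ Finset.range p, offD a b β lam 0 1 M (p + 1 + 1) (j + 1) * d (j + 1)
        = -(cA1 a b β 0 M (p + 1 + 1) (j + 1 + 1) *
            (d (j + 1) * Real.exp (-lam * (((p + 1 + 1 : ℕ) : ℝ) - (j + 1 : ℕ)) * gH a b M))
          + cA2 a b β 0 M (p + 1 + 1) (j + 1) *
            (d (j + 1) * Real.exp (-lam * (((p + 1 + 1 : ℕ) : ℝ) - (j + 1 : ℕ)) * gH a b M))) := by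
      intro j hj
      have := Finset.mem_range.1 hj
      rw [offD, if_pos (by omega), Nat.cast_zero, neg_zero, Real.rpow_zero]
      ring
    have h2 : offD a b β lam 0 1 M (p + 1 + 1) (p + 1) = -nearWeight a b β lam M
        - cA2 a b β 0 M (p + 1 + 1) (p + 1) * Real.exp (-lam * gH a b M) := by
      rw [offD, if_neg (by omega), if_pos rfl, nearWeight, Nat.add_sub_cancel]
    have e1 : (((p + 1 + 1 : ℕ) : ℝ) - (p + 1 : ℕ)) = 1 := by push_cast; ring
    rw [Finset.sum_congr rfl h1, Finset.sum_neg_distrib, Finset.sum_add_distrib, h2, leftWeight,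
      if_neg (by omega), e1, Nat.cast_zero, neg_zero, Real.rpow_zero]
    simp only [mul_one, Nat.cast_add, Nat.cast_one, sub_zero, zero_add]
    ring

lemma rightWeight_mul_sub_sum {M p q : ℕ} (hM : M = p + 1 + q) (d : ℕ → ℝ) :
    rightWeight a b β lam M p * d (M + 1)
        - ∑ r ∈ Finset.range q, offD a b β lam 0 1 M (p + 1) (p + 2 + r) * d (p + 2 + r)
      = nearWeight a b β lam M * d (p + 2) + ∑ l ∈ Finset.range q,
        (cA3 a b β 0 M (p + 1) (p + 2 + l + 1) *
            (d (p + 2 + l) * Real.exp (-lam * (((p + 2 + l : ℕ) : ℝ) - (p + 1 : ℕ)) * gH a b M))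
          + cA4 a b β 0 M (p + 1) (p + 2 + l + 1) *
            (d (p + 2 + l + 1) *
              Real.exp (-lam * (((p + 2 + l + 1 : ℕ) : ℝ) - (p + 1 : ℕ)) * gH a b M))) := by
  rcases q with _ | q
  · rw [add_zero] at hM
    simp [rightWeight, hM]
  · rw [Finset.sum_range_succ', Finset.sum_add_distrib, Finset.sum_range_succ',
      Finset.sum_range_succ (n := q)]
    have h1 : ∀ r ∈ Finset.range q, offD a b β lam 0 1 M (p + 1) (p + 2 + (r + 1)) *
          d (p + 2 + (r + 1))
        = -(cA3 a b β 0 M (p + 1) (p + 2 + (r + 1) + 1) * (d (p + 2 + (r + 1)) *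
            Real.exp (-lam * (((p + 2 + (r + 1) : ℕ) : ℝ) - (p + 1 : ℕ)) * gH a b M))
          + cA4 a b β 0 M (p + 1) (p + 2 + r + 1) * (d (p + 2 + r + 1) *
            Real.exp (-lam * (((p + 2 + r + 1 : ℕ) : ℝ) - (p + 1 : ℕ)) * gH a b M))) := by
      intro r hr
      rw [offD, if_neg (by omega), if_neg (by omega), if_neg (by omega), if_pos (by omega),
        Nat.cast_zero, neg_zero, Real.rpow_zero, ← add_assoc (p + 2) r 1]
      ring
    have h2 : offD a b β lam 0 1 M (p + 1) (p + 2 + 0) = -nearWeight a b β lam M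
        - cA3 a b β 0 M (p + 1) (p + 2 + 0 + 1) * Real.exp (-lam * gH a b M) := by
      rw [offD, if_neg (by omega), if_neg (by omega), if_pos (by omega), nearWeight]
    have e1 : (((p + 2 + 0 : ℕ) : ℝ) - (p + 1 : ℕ)) = 1 := by push_cast; ring
    have e2 : (((p + 2 + q + 1 : ℕ) : ℝ) - (p + 1 : ℕ)) = (M : ℝ) - p := by
      rw [hM]; push_cast; ring
    have e3 : p + 2 + q + 1 = M + 1 := by omega
    rw [Finset.sum_congr rfl h1, Finset.sum_neg_distrib, Finset.sum_add_distrib, h2, rightWeight,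
      if_neg (by omega), e1, e2, e3, Nat.cast_zero, neg_zero, Real.rpow_zero]
    simp only [add_zero, mul_one]
    ring

lemma sum_erase_fin_split {M p q : ℕ} (hM : M = p + 1 + q) (i : Fin M) (hi : i.val = p)
    (G : ℕ → ℝ) : ∑ k ∈ Finset.univ.erase i, G (k.val + 1)
      = ∑ j ∈ Finset.range p, G (j + 1) + ∑ r ∈ Finset.range q, G (p + 2 + r) := by
  subst hM
  rw [Finset.sum_erase_eq_sub (Finset.mem_univ i),
    Fin.sum_univ_eq_sum_range (fun k => G (k + 1)), Finset.sum_range_add, Finset.sum_range_succ, hi]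
  have : ∀ r, p + 1 + r + 1 = p + 2 + r := fun r => by omega
  simp only [this]
  ring

end Rows

section Consistency

variable {u u1 u2 f g : ℝ → ℝ} {a b K lam β : ℝ}

lemma temperedDiff_left {M p l : ℕ} (hab : a < b) (hl : l ≤ p + 1) :
    (u (gX a b M (p + 1)) - u (gX a b M l)) *
      Real.exp (-lam * (((p + 1 : ℕ) : ℝ) - (l : ℕ)) * gH a b M)
      = temperedDiff lam u (gX a b M (p + 1)) (gX a b M l) := by
  rw [temperedDiff, abs_of_nonneg (sub_nonneg.2 ((gX_strictMono hab M).monotone hl)), gX_sub,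
    mul_assoc (-lam)]

lemma temperedDiff_right {M p l : ℕ} (hab : a < b) (hl : p + 1 ≤ l) :
    (u (gX a b M (p + 1)) - u (gX a b M l)) *
      Real.exp (-lam * ((l : ℕ) - ((p + 1 : ℕ) : ℝ)) * gH a b M)
      = temperedDiff lam u (gX a b M (p + 1)) (gX a b M l) := by
  rw [temperedDiff, abs_of_nonpos (sub_nonpos.2 ((gX_strictMono hab M).monotone hl)), neg_sub,
    gX_sub, mul_assoc (-lam)]

/-- Truncation error of the scheme in the row of index `i`. -/
lemma abs_truncation_le (hab : a < b) (hβ : β ∈ Ico (1 : ℝ) 2) (hlam : 0 ≤ lam)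
    (hc : ContinuousOn u (Icc a b)) (hK : 0 ≤ K) (h0 : ∀ x ∈ Icc a b, |u x| ≤ K)
    (h1 : ∀ x ∈ Ioo a b, HasDerivAt u (u1 x) x ∧ HasDerivAt u1 (u2 x) x ∧
      |u1 x| ≤ K ∧ |u2 x| ≤ K)
    (hg : Measurable g) (hug : ∀ x, x ∉ Ioo a b → u x = g x)
    (hgint : ∀ x ∈ Ioo a b,
      IntegrableOn (fun y => |g y| * Real.exp (-lam * |x - y|) * |x - y| ^ (-1 - β))
        (Ioo a b)ᶜ volume)
    (hf : ∀ x ∈ Ioo a b, Tendsto (fun ε : ℝ => ∫ y in {y : ℝ | ε < |x - y|},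
        (u x - u y) * Real.exp (-lam * |x - y|) * |x - y| ^ (-1 - β))
      (nhdsWithin 0 (Ioi 0)) (nhds (f x)))
    {M : ℕ} (hM : 2 ≤ M) (i : Fin M) :
    |(stiff a b β lam 0 1 M).mulVec (fun j => u (gX a b M (j.val + 1))) i
        - loadF a b β lam 0 1 f g u M i|
      ≤ (2 * (K * (1 + 2 * lam + 2 * lam ^ 2)) + 2 * (8 * K / (2 - β))) * gH a b M ^ (2 - β) := by
  obtain ⟨hβ1, hβ2⟩ := hβ
  obtain ⟨p, hp⟩ : ∃ p, i.val = p := ⟨_, rfl⟩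
  obtain ⟨q, hq⟩ : ∃ q, M = p + 1 + q := ⟨M - (p + 1), by have := i.isLt; omega⟩
  have hh := gH_pos hab M
  set x := gX a b M (p + 1) with hx
  set h := gH a b M with hhd
  have hxl : gX a b M p = x - h := by rw [hx, gX_succ]; ring
  have hxr : gX a b M (p + 2) = x + h := by rw [hx, ← gX_succ]
  have hl : a ≤ x - h := by rw [← hxl]; exact (gX_mem_Icc hab (by omega)).1
  have hr : x + h ≤ b := by rw [← hxr]; exact (gX_mem_Icc hab (by omega)).2
  have hxm : x ∈ Ioo a b := ⟨by linarith, by linarith⟩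
  set ν := nearWeight a b β lam M with hν
  set d : ℕ → ℝ := fun j => u x - u (gX a b M j) with hd
  have hL := leftWeight_mul_sub_sum (a := a) (b := b) (β := β) (lam := lam) M p d
  have hR := rightWeight_mul_sub_sum (a := a) (b := b) (β := β) (lam := lam) hq d
  have qL := abs_integral_left_sub_sum_le hab hβ1 hlam hc h0 h1 (M := M) (p := p) (by omega)
  have qR := abs_integral_right_sub_sum_le hab hβ1 hlam hc h0 h1 hq
  have eL : ∀ l ∈ Finset.range p, cA1 a b β 0 M (p + 1) (l + 1) *
            (d l * Real.exp (-lam * (((p + 1 : ℕ) : ℝ) - l) * gH a b M))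
          + cA2 a b β 0 M (p + 1) (l + 1) *
            (d (l + 1) * Real.exp (-lam * (((p + 1 : ℕ) : ℝ) - (l + 1 : ℕ)) * gH a b M))
      = cA1 a b β 0 M (p + 1) (l + 1) * temperedDiff lam u x (gX a b M l)
      + cA2 a b β 0 M (p + 1) (l + 1) * temperedDiff lam u x (gX a b M (l + 1)) := fun l hl => by
    have := Finset.mem_range.1 hl
    rw [hd, temperedDiff_left hab (by omega), temperedDiff_left hab (by omega)]
  have eR : ∀ l ∈ Finset.range q, cA3 a b β 0 M (p + 1) (p + 2 + l + 1) *
            (d (p + 2 + l) * Real.exp (-lam * (((p + 2 + l : ℕ) : ℝ) - (p + 1 : ℕ)) * gH a b M))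
          + cA4 a b β 0 M (p + 1) (p + 2 + l + 1) *
            (d (p + 2 + l + 1) *
              Real.exp (-lam * (((p + 2 + l + 1 : ℕ) : ℝ) - (p + 1 : ℕ)) * gH a b M))
      = cA3 a b β 0 M (p + 1) (p + 2 + l + 1) * temperedDiff lam u x (gX a b M (p + 2 + l))
      + cA4 a b β 0 M (p + 1) (p + 2 + l + 1) *
        temperedDiff lam u x (gX a b M (p + 2 + l + 1)) := fun l hl => by
    rw [hd, temperedDiff_right hab (by omega), temperedDiff_right hab (by omega)]
  rw [Finset.sum_congr rfl eL] at hL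
  rw [Finset.sum_congr rfl eR] at hR
  rw [← hx, hxl] at qL
  rw [← hx, hxr] at qR
  set SL := ∑ l ∈ Finset.range p,
    (cA1 a b β 0 M (p + 1) (l + 1) * temperedDiff lam u x (gX a b M l)
      + cA2 a b β 0 M (p + 1) (l + 1) * temperedDiff lam u x (gX a b M (l + 1)))
  set SR := ∑ l ∈ Finset.range q,
    (cA3 a b β 0 M (p + 1) (p + 2 + l + 1) * temperedDiff lam u x (gX a b M (p + 2 + l))
      + cA4 a b β 0 M (p + 1) (p + 2 + l + 1) *
        temperedDiff lam u x (gX a b M (p + 2 + l + 1)))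
  set IL := ∫ y in a..(x - h), temperedDiff lam u x y * |x - y| ^ (-1 - β)
  set IR := ∫ y in (x + h)..b, temperedDiff lam u x y * |x - y| ^ (-1 - β)
  set R := u x * (cB1 a b β lam M (p + 1) + cB2 a b β lam M (p + 1))
    - dd1 a b β lam g M (p + 1) - dd2 a b β lam g M (p + 1) + IL + IR with hRd
  have hfR : |f x - R| ≤ 8 * K / (2 - β) * h ^ (2 - β) := by
    refine le_of_tendsto (((hf x hxm).sub_const R).abs) ?_
    filter_upwards [Ioo_mem_nhdsGT hh] with ε hε
    rw [integral_truncated hg hug (hgint x hxm) hβ1 hlam hc hε.1 hε.2 hl hr]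
    refine le_of_eq_of_le (congrArg abs ?_)
      (abs_integral_near_le hlam hc h1 hK hβ2 hε.1 hε.2 hl hr)
    simp only [hRd, cB1, cB2, dd1, dd2, ← hx]
    ring
  have hnear : |ν * (d p + d (p + 2))| ≤ 8 * K / (2 - β) * h ^ (2 - β) := by
    have h2 := abs_second_difference_le (x := x) hc h1 hh hl hr
    have e : d p + d (p + 2) = 2 * u x - u (x - h) - u (x + h) := by
      simp only [hd, hxl, hxr]; ring
    have hβ' : 0 < 2 - β := by linarith
    have hν0 : ν = h ^ (-β) * Real.exp (-lam * h) / (2 - β) := by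
      rw [hν, nearWeight, ← hhd]; norm_num
    have hν1 : |ν| ≤ h ^ (-β) / (2 - β) := by
      have hp0 := Real.rpow_nonneg hh.le (-β)
      rw [hν0, abs_of_nonneg (by positivity)]
      gcongr
      exact mul_le_of_le_one_right hp0 (Real.exp_le_one_iff.2 (by nlinarith))
    rw [abs_mul, e]
    calc _ ≤ h ^ (-β) / (2 - β) * (8 * K * h ^ 2) := by gcongr
      _ = 8 * K / (2 - β) * (h ^ 2 * h ^ (-β)) := by ring
      _ = _ := by rw [sq_mul_rpow_neg hh]
  have hd0 : d 0 = u x - u a := by simp only [hd, gX_zero]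
  have hdM : d (M + 1) = u x - u b := by simp only [hd, gX_last]
  have hrow : (stiff a b β lam 0 1 M).mulVec (fun j => u (gX a b M (j.val + 1))) i
        - loadF a b β lam 0 1 f g u M i
      = -(f x - R) - (IL - SL) - (IR - SR) + ν * (d p + d (p + 2)) := by
    have hF : loadF a b β lam 0 1 f g u M i = f x + dd1 a b β lam g M (p + 1)
        + dd2 a b β lam g M (p + 1) + leftWeight a b β lam M p * u a
        + rightWeight a b β lam M p * u b := by
      rw [loadF, hp]; rfl
    rw [stiff_mulVec, hp, sum_erase_fin_split hq i hp
      (fun k => offD a b β lam 0 1 M (p + 1) k * (u (gX a b M (p + 1)) - u (gX a b M k))),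
      hF, diagExtra_eq hM]
    rw [hd0] at hL
    rw [hdM] at hR
    simp only [← hx] at hL hR ⊢
    simp only [hRd]
    linear_combination hL + hR
  rw [hrow]
  calc _ ≤ |f x - R| + |IL - SL| + |IR - SR| + |ν * (d p + d (p + 2))| := by
        refine (abs_add_le _ _).trans (add_le_add ((abs_sub _ _).trans (add_le_add
          ((abs_sub _ _).trans (add_le_add (by rw [abs_neg]) le_rfl)) le_rfl)) le_rfl)
    _ ≤ _ := by linarith

end Consistency

lemma dnorm2_le {a b T : ℝ} (hab : a < b) {M : ℕ} {v : Fin M → ℝ} (hT : 0 ≤ T)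
    (hv : ∀ i, |v i| ≤ T) : dnorm2 a b M v ≤ Real.sqrt (b - a) * T := by
  have hh := gH_pos hab M
  have hs : ∑ i, v i ^ 2 ≤ M * T ^ 2 := by
    calc ∑ i, v i ^ 2 ≤ ∑ _i : Fin M, T ^ 2 := Finset.sum_le_sum fun i _ => by
          rw [← sq_abs]; exact pow_le_pow_left₀ (abs_nonneg _) (hv i) 2
      _ = M * T ^ 2 := by simp
  have hM : gH a b M * M ≤ b - a := by
    have : gH a b M * (M + 1) = b - a := by
      have : (M : ℝ) + 1 ≠ 0 := by positivity
      rw [gH]; field_simp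
    nlinarith
  rw [dnorm2, ← Real.sqrt_sq hT, ← Real.sqrt_mul (sub_nonneg.2 hab.le)]
  refine Real.sqrt_le_sqrt ?_
  calc _ ≤ gH a b M * (M * T ^ 2) := by gcongr
    _ = gH a b M * M * T ^ 2 := by ring
    _ ≤ _ := by gcongr

/-- convergence of the finite difference scheme, case `β ∈ [1,2)`, `s = 0`,
`s₁ = 1`, `u ∈ C³([a,b])`: there are constants `C₁, C₂ > 0`, independent of `M` and `h`, such
that for every `M ≥ 3` the system `H U_h = F` has a unique solution `U_h`, with
`‖U − U_h‖ ≤ C₁ h^{2−β}` and `‖U − U_h‖_∞ ≤ C₂ h^{2−β}`. -/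
theorem scheme_convergence_beta_ge_one_s0 (a b β lam : ℝ)
    (hab : a < b) (hβ : β ∈ Set.Ico (1 : ℝ) 2) (hlam : 0 ≤ lam)
    (u g f : ℝ → ℝ)
    (hu : ContDiffOn ℝ 3 u (Set.Icc a b))
    (hg : Measurable g)
    (hug : ∀ x, x ∉ Set.Ioo a b → u x = g x)
    (hgint : ∀ x ∈ Set.Ioo a b,
      IntegrableOn (fun y => |g y| * Real.exp (-lam * |x - y|) * |x - y| ^ (-1 - β))
        (Set.Ioo a b)ᶜ volume)
    (hf : ∀ x ∈ Set.Ioo a b,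
      Filter.Tendsto
        (fun ε : ℝ => ∫ y in {y : ℝ | ε < |x - y|},
          (u x - u y) * Real.exp (-lam * |x - y|) * |x - y| ^ (-1 - β))
        (nhdsWithin 0 (Set.Ioi 0)) (nhds (f x))) :
    ∃ C₁ > (0 : ℝ), ∃ C₂ > (0 : ℝ), ∀ M : ℕ, 3 ≤ M →
      (∃! Uh : Fin M → ℝ,
        (stiff a b β lam 0 1 M).mulVec Uh = loadF a b β lam 0 1 f g u M) ∧
      ∀ Uh : Fin M → ℝ,
        (stiff a b β lam 0 1 M).mulVec Uh = loadF a b β lam 0 1 f g u M →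
          dnorm2 a b M (fun i => u (gX a b M (i.val + 1)) - Uh i)
              ≤ C₁ * gH a b M ^ (2 - β) ∧
            ∀ i : Fin M, |u (gX a b M (i.val + 1)) - Uh i| ≤ C₂ * gH a b M ^ (2 - β) := by
  obtain ⟨u1, u2, K, hK, h0, h1⟩ := exists_deriv_bounds hab hu
  have hc := hu.continuousOn
  have hβ' : 0 < 2 - β := by linarith [hβ.2]
  have hba : 0 < b - a := sub_pos.2 hab
  set c := Real.exp (-lam * (b - a + 1)) * (b - a + 1) ^ (-1 - β) with hcd
  have hc0 : 0 < c := mul_pos (Real.exp_pos _) (Real.rpow_pos_of_pos (by linarith) _)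
  set C := 2 * (K * (1 + 2 * lam + 2 * lam ^ 2)) + 2 * (8 * K / (2 - β)) + 1 with hCd
  have hC : 0 < C := by positivity
  refine ⟨Real.sqrt (b - a) * (C / c), by positivity, C / c, by positivity, fun M hM => ?_⟩
  have hh := gH_pos hab M
  have hx : ∀ i : Fin M, gX a b M (i.val + 1) ∈ Ioo a b := fun i => by
    have h2 := gX_strictMono hab M (show 0 < i.val + 1 by omega)
    have h3 := gX_strictMono hab M (show i.val + 1 < M + 1 by omega)
    rw [gX_zero] at h2
    rw [gX_last] at h3
    exact ⟨h2, h3⟩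
  have hoff : ∀ i j, i ≠ j → stiff a b β lam 0 1 M i j ≤ 0 := fun i j hij => by
    rw [stiff, if_neg hij]
    exact offD_nonpos hab hβ.2 (by omega)
  have hrow : ∀ i, c ≤ ∑ j, stiff a b β lam 0 1 M i j := fun i => by
    have h := stiff_mulVec (a := a) (b := b) (β := β) (lam := lam) 0 1 M (fun _ => 1) i
    simp only [Matrix.mulVec, dotProduct, mul_one, sub_self, mul_zero, Finset.sum_const_zero,
      sub_zero] at h
    rw [h]
    have b1 := le_cB1 hβ.1 hlam (hx i)
    have b2 := cB2_nonneg (β := β) (lam := lam) (hx i).2.le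
    have b3 := diagExtra_nonneg (lam := lam) (M := M) hab hβ.2 (show 1 ≤ i.val + 1 by omega)
      (show i.val + 1 ≤ M by omega)
    linarith
  refine ⟨existsUnique_mulVec_eq hc0 hoff hrow _, fun Uh hUh => ?_⟩
  have hsup : ∀ i : Fin M, |u (gX a b M (i.val + 1)) - Uh i| ≤ C / c * gH a b M ^ (2 - β) := by
    intro i
    have := abs_le_of_mulVec_le hc0 hoff hrow (e := (fun j : Fin M => u (gX a b M (j.val + 1))) - Uh)
      (T := C * gH a b M ^ (2 - β)) (fun j => by
        rw [Matrix.mulVec_sub, hUh, Pi.sub_apply]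
        refine (abs_truncation_le hab hβ hlam hc hK h0 h1 hg hug hgint hf (by omega) j).trans ?_
        gcongr
        linarith) i
    rw [Pi.sub_apply] at this
    rwa [div_mul_eq_mul_div]
  refine ⟨?_, hsup⟩
  rw [mul_assoc]
  exact dnorm2_le hab (by positivity) hsup

end
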